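/- The corule s-converge inductively subsumes the plain rules of the fair-subtyping GIS: Ind(I_F ∪ Ico_F) = Ind(Ico_F). -/

import Mathlib

/-- An inference system over a universe `U`: a set of rules `(premises, conclusion)`. -/
abbrev InfSys (U : Type) := Set (Set U × U)

/-- The (monotone) inference operator associated with an inference system. -/
def infOp {U : Type} (I : InfSys U) : Set U →o Set U where
  toFun X := {j | ∃ pr, pr ⊆ X ∧ (pr, j) ∈ I}
  monotone' := by
    intro X Y h j hj
    obtain ⟨pr, hpr, hr⟩ := hj
    exact ⟨pr, hpr.trans h, hr⟩

/-- Inductive interpretation: least fixed point of the inference operator. -/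
def Ind {U : Type} (I : InfSys U) : Set U := OrderHom.lfp (infOp I)

/-- Coinductive interpretation: greatest fixed point of the inference operator. -/
def CoInd {U : Type} (I : InfSys U) : Set U := OrderHom.gfp (infOp I)

/-- Interpretation of a generalized inference system `(I, Ico)`: the greatest
post-fixed point of `infOp I` included in `Ind (I ∪ Ico)`, i.e. the union of
all `X` with `X ⊆ infOp I X` and `X ⊆ Ind (I ∪ Ico)`. -/
def Gen {U : Type} (I Ico : InfSys U) : Set U :=
  sSup {X | X ⊆ infOp I X ∧ X ⊆ Ind (I ∪ Ico)}

/-- Tags for the three constructors of session types. -/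
inductive STag : Type | nil | inp | out

/-- The polynomial functor `X ↦ Unit ⊕ (V → X) ⊕ (V → X)`. -/
def STF (V : Type) : PFunctor.{0} := ⟨STag, fun t => match t with
  | .nil => Empty
  | .inp => V
  | .out => V⟩

/-- Session types over `V`: the final coalgebra (M-type) of `STF V`. -/
def SessionType (V : Type) : Type := (STF V).M

/-- The `nil` session type. -/
def SessionType.nil (V : Type) : SessionType V := PFunctor.M.mk ⟨STag.nil, Empty.elim⟩

/-- Input session type. -/
def SessionType.inp {V : Type} (f : V → SessionType V) : SessionType V :=
  PFunctor.M.mk ⟨STag.inp, f⟩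

/-- Output session type. -/
def SessionType.out {V : Type} (f : V → SessionType V) : SessionType V :=
  PFunctor.M.mk ⟨STag.out, f⟩

/-- Input/output actions `?x` and `!x`. -/
inductive Act (V : Type) : Type
  | inp (x : V)
  | out (x : V)

/-- Labeled transitions of session types:
`inp f −?x→ f x` for every `x`, and `out f −!x→ f x` for every `x ∈ dom f`. -/
inductive Transition {V : Type} : SessionType V → Act V → SessionType V → Prop
  | inp (f : V → SessionType V) (x : V) : Transition (.inp f) (.inp x) (f x)
  | out (f : V → SessionType V) (x : V) :
      f x ≠ SessionType.nil V → Transition (.out f) (.out x) (f x)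

/-- `TransSeq T φ S` means `T ⇒φ S` (composite of transitions along `φ`). -/
inductive TransSeq {V : Type} : SessionType V → List (Act V) → SessionType V → Prop
  | refl (T : SessionType V) : TransSeq T [] T
  | step {T T' S : SessionType V} {α : Act V} {φ : List (Act V)} :
      Transition T α T' → TransSeq T' φ S → TransSeq T (α :: φ) S

/-- Traces of a session type: `{φ | ∃ S ≠ nil, T ⇒φ S}`. -/
def Traces {V : Type} (T : SessionType V) : Set (List (Act V)) :=
  {φ | ∃ S, S ≠ SessionType.nil V ∧ TransSeq T φ S}

/-- Fair termination: each trace extends to a maximal one. -/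
def FairlyTerminating {V : Type} (T : SessionType V) : Prop :=
  ∀ φ ∈ Traces T, ∃ ψ, (φ ++ ψ) ∈ Traces T ∧ ∀ χ, ((φ ++ ψ) ++ χ) ∈ Traces T → χ = []

/-- Plain rules `I_F` of the fair-subtyping GIS (s-nil, s-end, s-inp, s-out). -/
def IF (V : Type) : InfSys (SessionType V × SessionType V) :=
  {r | ∃ T, r = (∅, (SessionType.nil V, T))} ∪
  {r | ∃ (f : V → SessionType V) (T : SessionType V),
        (∀ x, f x = SessionType.nil V) ∧ T ≠ SessionType.nil V ∧
        (r = (∅, (SessionType.inp f, T)) ∨ r = (∅, (SessionType.out f, T)))} ∪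
  {r | ∃ f g, (∃ x, f x ≠ SessionType.nil V) ∧
        (∀ x, f x ≠ SessionType.nil V → g x ≠ SessionType.nil V) ∧
        r = ({p | ∃ x, f x ≠ SessionType.nil V ∧ p = (f x, g x)},
             (SessionType.inp f, SessionType.inp g))} ∪
  {r | ∃ f g, (∃ x, g x ≠ SessionType.nil V) ∧
        (∀ x, g x ≠ SessionType.nil V → f x ≠ SessionType.nil V) ∧
        r = ({p | ∃ x, g x ≠ SessionType.nil V ∧ p = (f x, g x)},
             (SessionType.out f, SessionType.out g))}

/-- Corules `Ico_F` of the fair-subtyping GIS (s-converge): all rules `(pr, (T, S))`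
such that for every `φ ∈ traces T \ traces S` there are a prefix `ψ` of `φ` and a
value `x` with `ψ·!x ∈ traces T ∩ traces S` and `(T(ψ·!x), S(ψ·!x)) ∈ pr`. -/
def IcoF (V : Type) : InfSys (SessionType V × SessionType V) :=
  {r | ∀ φ ∈ Traces r.2.1, φ ∉ Traces r.2.2 →
        ∃ ψ x, ψ <+: φ ∧
          ∃ T' S', T' ≠ SessionType.nil V ∧ S' ≠ SessionType.nil V ∧
            TransSeq r.2.1 (ψ ++ [Act.out x]) T' ∧
            TransSeq r.2.2 (ψ ++ [Act.out x]) S' ∧ (T', S') ∈ r.1}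

namespace SessionType

variable {V : Type}

theorem inp_ne_nil (f : V → SessionType V) : inp f ≠ nil V := fun h =>
  STag.noConfusion (congrArg Sigma.fst (PFunctor.M.mk_inj h))

theorem out_ne_nil (f : V → SessionType V) : out f ≠ nil V := fun h =>
  STag.noConfusion (congrArg Sigma.fst (PFunctor.M.mk_inj h))

theorem inp_ne_out (f g : V → SessionType V) : inp f ≠ out g := fun h =>
  STag.noConfusion (congrArg Sigma.fst (PFunctor.M.mk_inj h))

theorem inp_injective : Function.Injective (inp (V := V)) := fun _ _ h =>
  eq_of_heq (Sigma.mk.inj (PFunctor.M.mk_inj h)).2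

theorem out_injective : Function.Injective (out (V := V)) := fun _ _ h =>
  eq_of_heq (Sigma.mk.inj (PFunctor.M.mk_inj h)).2

end SessionType

section Traces

variable {V : Type}

open SessionType

theorem not_transition_nil (α : Act V) (S : SessionType V) : ¬ Transition (nil V) α S := by
  intro h
  generalize hT : nil V = T at h
  cases h with
  | inp f x => exact inp_ne_nil f hT.symm
  | out f x _ => exact out_ne_nil f hT.symm

theorem Transition.of_inp {f : V → SessionType V} {α : Act V} {S : SessionType V}
    (h : Transition (SessionType.inp f) α S) : ∃ x, α = Act.inp x ∧ S = f x := by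
  generalize hT : SessionType.inp f = T at h
  cases h with
  | inp g x => exact ⟨x, rfl, by rw [inp_injective hT]⟩
  | out g x _ => exact absurd hT (inp_ne_out f g)

theorem Transition.of_out {f : V → SessionType V} {α : Act V} {S : SessionType V}
    (h : Transition (SessionType.out f) α S) : ∃ x, α = Act.out x ∧ f x ≠ nil V ∧ S = f x := by
  generalize hT : SessionType.out f = T at h
  cases h with
  | inp g x => exact absurd hT.symm (inp_ne_out g f)
  | out g x hx => exact ⟨x, rfl, by rwa [out_injective hT], by rw [out_injective hT]⟩

theorem notMem_traces_nil (φ : List (Act V)) : φ ∉ Traces (nil V) := by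
  rintro ⟨S, hS, h⟩
  cases h with
  | refl => exact hS rfl
  | step ht _ => exact not_transition_nil _ _ ht

theorem ne_nil_of_mem_traces {T : SessionType V} {φ : List (Act V)} (h : φ ∈ Traces T) :
    T ≠ nil V := by
  rintro rfl
  exact notMem_traces_nil φ h

theorem nil_mem_traces {T : SessionType V} (h : T ≠ nil V) : [] ∈ Traces T :=
  ⟨T, h, .refl T⟩

theorem mem_traces_inp {f : V → SessionType V} {φ : List (Act V)} (h : φ ∈ Traces (inp f)) :
    φ = [] ∨ ∃ x φ', φ = Act.inp x :: φ' ∧ φ' ∈ Traces (f x) := by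
  obtain ⟨S, hS, h⟩ := h
  cases h with
  | refl => exact .inl rfl
  | step ht hs =>
    obtain ⟨x, rfl, rfl⟩ := ht.of_inp
    exact .inr ⟨x, _, rfl, S, hS, hs⟩

theorem mem_traces_out {f : V → SessionType V} {φ : List (Act V)} (h : φ ∈ Traces (out f)) :
    φ = [] ∨ ∃ x φ', φ = Act.out x :: φ' ∧ φ' ∈ Traces (f x) := by
  obtain ⟨S, hS, h⟩ := h
  cases h with
  | refl => exact .inl rfl
  | step ht hs =>
    obtain ⟨x, rfl, -, rfl⟩ := ht.of_out
    exact .inr ⟨x, _, rfl, S, hS, hs⟩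

theorem cons_mem_traces_inp {f : V → SessionType V} {x : V} {φ : List (Act V)}
    (h : φ ∈ Traces (f x)) : Act.inp x :: φ ∈ Traces (inp f) := by
  obtain ⟨S, hS, h⟩ := h
  exact ⟨S, hS, .step (.inp f x) h⟩

end Traces

section Inference

theorem infOp_Ind {U : Type} (I : InfSys U) : infOp I (Ind I) = Ind I :=
  OrderHom.map_lfp _

theorem infOp_union {U : Type} (I J : InfSys U) (X : Set U) :
    infOp (I ∪ J) X = infOp I X ∪ infOp J X := by
  ext j
  constructor
  · rintro ⟨pr, hpr, h | h⟩
    exacts [.inl ⟨pr, hpr, h⟩, .inr ⟨pr, hpr, h⟩]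
  · rintro (⟨pr, hpr, h⟩ | ⟨pr, hpr, h⟩)
    exacts [⟨pr, hpr, .inl h⟩, ⟨pr, hpr, .inr h⟩]

variable {V : Type}

/-- Premises of s-converge may be enlarged. -/
theorem IcoF_mono {pr pr' : Set (SessionType V × SessionType V)}
    {j : SessionType V × SessionType V} (hpr : pr ⊆ pr') (h : (pr, j) ∈ IcoF V) :
    (pr', j) ∈ IcoF V := by
  intro φ hφ hφ'
  obtain ⟨ψ, x, hψ, T', S', hT', hS', hT, hS, hm⟩ := h φ hφ hφ'
  exact ⟨ψ, x, hψ, T', S', hT', hS', hT, hS, hpr hm⟩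

theorem mem_Ind_IcoF_iff {j : SessionType V × SessionType V} :
    j ∈ Ind (IcoF V) ↔ (Ind (IcoF V), j) ∈ IcoF V := by
  constructor
  · intro h
    rw [← infOp_Ind] at h
    obtain ⟨pr, hpr, h⟩ := h
    exact IcoF_mono hpr h
  · intro h
    rw [← infOp_Ind]
    exact ⟨_, subset_rfl, h⟩

theorem mem_Ind_IcoF_of_traces_subset {T S : SessionType V} (h : Traces T ⊆ Traces S) :
    (T, S) ∈ Ind (IcoF V) :=
  mem_Ind_IcoF_iff.2 fun _ hφ hφ' => absurd (h hφ) hφ'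

/-- The pairs derivable by s-converge alone are closed under s-inp. -/
theorem inp_mem_Ind_IcoF {f g : V → SessionType V}
    (h : ∀ x, f x ≠ SessionType.nil V → (f x, g x) ∈ Ind (IcoF V)) :
    (SessionType.inp f, SessionType.inp g) ∈ Ind (IcoF V) := by
  refine mem_Ind_IcoF_iff.2 fun φ hφ hφ' => ?_
  rcases mem_traces_inp hφ with rfl | ⟨x, χ, rfl, hχ⟩
  · exact absurd (nil_mem_traces (SessionType.inp_ne_nil g)) hφ'
  · obtain ⟨ψ, y, hψ, T', S', hT', hS', hT, hS, hm⟩ :=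
      mem_Ind_IcoF_iff.1 (h x (ne_nil_of_mem_traces hχ)) χ hχ
        fun hc => hφ' (cons_mem_traces_inp hc)
    exact ⟨Act.inp x :: ψ, y, List.cons_prefix_cons.2 ⟨rfl, hψ⟩, T', S', hT', hS',
      .step (.inp f x) hT, .step (.inp g x) hS, hm⟩

/-- The pairs derivable by s-converge alone are closed under s-out; one premise suffices. -/
theorem out_mem_Ind_IcoF {f g : V → SessionType V} {x : V} (hf : f x ≠ SessionType.nil V)
    (hg : g x ≠ SessionType.nil V) (h : (f x, g x) ∈ Ind (IcoF V)) :
    (SessionType.out f, SessionType.out g) ∈ Ind (IcoF V) :=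
  mem_Ind_IcoF_iff.2 fun _ _ _ => ⟨[], x, List.nil_prefix, f x, g x, hf, hg,
    .step (.out f x hf) (.refl _), .step (.out g x hg) (.refl _), h⟩

theorem infOp_IF_Ind_IcoF_subset : infOp (IF V) (Ind (IcoF V)) ⊆ Ind (IcoF V) := by
  rintro j ⟨pr, hpr, ((⟨T, h⟩ | ⟨f, T, hf, hT, h⟩) | ⟨f, g, -, -, h⟩) | ⟨f, g, ⟨x, hx⟩, hgf, h⟩⟩
  · obtain ⟨-, rfl⟩ := Prod.mk.inj h
    exact mem_Ind_IcoF_of_traces_subset fun φ hφ => absurd hφ (notMem_traces_nil φ)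
  · rcases h with h | h <;> obtain ⟨-, rfl⟩ := Prod.mk.inj h <;>
      refine mem_Ind_IcoF_of_traces_subset fun φ hφ => ?_
    · rcases mem_traces_inp hφ with rfl | ⟨x, χ, -, hχ⟩
      exacts [nil_mem_traces hT, absurd (hf x) (ne_nil_of_mem_traces hχ)]
    · rcases mem_traces_out hφ with rfl | ⟨x, χ, -, hχ⟩
      exacts [nil_mem_traces hT, absurd (hf x) (ne_nil_of_mem_traces hχ)]
  · obtain ⟨rfl, rfl⟩ := Prod.mk.inj h
    exact inp_mem_Ind_IcoF fun x hx => hpr ⟨x, hx, rfl⟩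
  · obtain ⟨rfl, rfl⟩ := Prod.mk.inj h
    exact out_mem_Ind_IcoF (hgf x hx) hx (hpr ⟨x, hx, rfl⟩)

end Inference

/-- The corule s-converge inductively subsumes the plain rules of the
fair-subtyping GIS. -/
theorem stmt19 {V : Type} [Nontrivial V] :
    Ind (IF V ∪ IcoF V) = Ind (IcoF V) := by
  apply subset_antisymm
  · refine OrderHom.lfp_le _ ?_
    rw [infOp_union, infOp_Ind]
    exact Set.union_subset infOp_IF_Ind_IcoF_subset subset_rfl
  · refine OrderHom.lfp_le _ ?_
    conv_rhs => rw [← infOp_Ind, infOp_union]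
    exact Set.subset_union_right
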